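/- Let L be a language over a finite alphabet Σ that does not contain the empty word and is closed under GSCO (GSCO(L) ⊆ L). Let B be the set of all length-two factors of words of L, let S ⊆ Σ be the set of first letters of words of L, and let E ⊆ Σ be the set of last letters of words of L. Then L = (GSCO*(B) ∩ SΣ*E) ∪ (L ∩ Σ), where SΣ*E denotes the set of words of length at least 2 whose first letter lies in S and whose last letter lies in E, and L ∩ Σ denotes the set of one-letter words of L. -/

import Mathlib

/-- `x` is a factor (subword) of `w`. -/
def IsFactor {α : Type*} (x w : List α) : Prop := ∃ u v, w = u ++ x ++ v

/-- `GSCO_x(w₁,w₂)`: the two-output crossover of words over `x`. -/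
def gscoX {α : Type*} (x w₁ w₂ : List α) : Set (List α) :=
  {w | ∃ u₁ v₁ u₂ v₂, w₁ = u₁ ++ x ++ v₁ ∧ w₂ = u₂ ++ x ++ v₂ ∧
        (w = u₁ ++ x ++ v₂ ∨ w = u₂ ++ x ++ v₁)}

/-- `GSCO(w₁,w₂)`: union over all nonempty common subwords. -/
def gsco {α : Type*} (w₁ w₂ : List α) : Set (List α) :=
  ⋃ x ∈ {x : List α | x ≠ [] ∧ IsFactor x w₁ ∧ IsFactor x w₂}, gscoX x w₁ w₂

/-- `GSCO(K)` for a language `K`. -/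
def gscoL {α : Type*} (K : Set (List α)) : Set (List α) :=
  ⋃ w₁ ∈ K, ⋃ w₂ ∈ K, gsco w₁ w₂

/-- `GSCO^i(K)`: the iterated crossover. -/
def gscoIter {α : Type*} (K : Set (List α)) : ℕ → Set (List α)
  | 0 => K
  | i + 1 => gscoIter K i ∪ gscoL (gscoIter K i)

/-- `GSCO*(K)`: the iterated crossover closure. -/
def gscoStar {α : Type*} (K : Set (List α)) : Set (List α) :=
  ⋃ i : ℕ, gscoIter K i

theorem gscoL_cross {α : Type*} {K : Set (List α)} {u₁ v₁ u₂ v₂ : List α} {c : α}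
    (h1 : u₁ ++ [c] ++ v₁ ∈ K) (h2 : u₂ ++ [c] ++ v₂ ∈ K) : u₁ ++ [c] ++ v₂ ∈ gscoL K := by
  simp only [gscoL, gsco, Set.mem_iUnion]
  exact ⟨_, h1, _, h2, [c], ⟨by simp, ⟨_, _, rfl⟩, ⟨_, _, rfl⟩⟩,
    ⟨u₁, v₁, u₂, v₂, rfl, rfl, Or.inl rfl⟩⟩

theorem gscoIter_mono {α : Type*} (K : Set (List α)) : Monotone (gscoIter K) :=
  monotone_nat_of_le_succ fun _ => Set.subset_union_left

theorem gscoStar_cross {α : Type*} {K : Set (List α)} {u₁ v₁ u₂ v₂ : List α} {c : α}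
    (h1 : u₁ ++ [c] ++ v₁ ∈ gscoStar K) (h2 : u₂ ++ [c] ++ v₂ ∈ gscoStar K) :
    u₁ ++ [c] ++ v₂ ∈ gscoStar K := by
  obtain ⟨i, hi⟩ := Set.mem_iUnion.1 h1
  obtain ⟨j, hj⟩ := Set.mem_iUnion.1 h2
  refine Set.mem_iUnion.2 ⟨max i j + 1, Or.inr ?_⟩
  exact gscoL_cross (gscoIter_mono K (le_max_left i j) hi) (gscoIter_mono K (le_max_right i j) hj)

theorem chain_cross {α : Type*} {R : α → α → Prop} {u₁ x v₁ u₂ v₂ : List α} (hx : x ≠ [])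
    (h1 : List.IsChain R (u₁ ++ x ++ v₁)) (h2 : List.IsChain R (u₂ ++ x ++ v₂)) :
    List.IsChain R (u₁ ++ x ++ v₂) := by
  have a := h1.left_of_append
  rw [List.append_assoc] at h2
  have b := h2.right_of_append
  rw [List.isChain_append] at b ⊢
  refine ⟨a, b.2.1, ?_⟩
  intro p hp q hq
  refine b.2.2 p ?_ q hq
  rwa [List.getLast?_append_of_ne_nil _ hx] at hp

theorem chain_star {α : Type*} {K : Set (List α)} {R : α → α → Prop}
    (hK : ∀ w ∈ K, List.IsChain R w) : ∀ w ∈ gscoStar K, List.IsChain R w := by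
  intro w hw
  obtain ⟨i, hi⟩ := Set.mem_iUnion.1 hw
  clear hw
  induction i generalizing w with
  | zero => exact hK w hi
  | succ i ih =>
    rcases hi with hi | hi
    · exact ih w hi
    · simp only [gscoL, gsco, Set.mem_iUnion] at hi
      obtain ⟨w₁, h1, w₂, h2, x, ⟨hx, -, -⟩, u₁, v₁, u₂, v₂, rfl, rfl, h⟩ := hi
      rcases h with rfl | rfl
      · exact chain_cross hx (ih _ h1) (ih _ h2)
      · exact chain_cross hx (ih _ h2) (ih _ h1)

theorem star_of_chain {α : Type*} {K : Set (List α)} (m : List α) : ∀ a b : α,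
    List.IsChain (fun a b => [a, b] ∈ K) (a :: b :: m) → a :: b :: m ∈ gscoStar K := by
  induction m with
  | nil =>
    intro a b h
    exact Set.mem_iUnion.2 ⟨0, by simpa [gscoIter] using h⟩
  | cons c m ih =>
    intro a b h
    rw [List.isChain_cons_cons] at h
    have h1 : [a] ++ [b] ++ [] ∈ gscoStar K := Set.mem_iUnion.2 ⟨0, h.1⟩
    have h2 : [] ++ [b] ++ (c :: m) ∈ gscoStar K := ih b c h.2
    exact gscoStar_cross h1 h2

theorem extend_chain {α : Type*} {L : Set (List α)} (hclosed : gscoL L ⊆ L) (m : List α) :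
    ∀ (p : List α) (c : α), (∃ v, p ++ [c] ++ v ∈ L) →
    List.IsChain (fun a b => ∃ w ∈ L, IsFactor [a, b] w) (c :: m) →
    ∃ v, p ++ (c :: m) ++ v ∈ L := by
  induction m with
  | nil => intro p c h _; exact h
  | cons d m ih =>
    rintro p c ⟨v, hv⟩ h
    rw [List.isChain_cons_cons] at h
    obtain ⟨⟨w, hw, s, t, rfl⟩, h⟩ := h
    have hw' : s ++ [c] ++ (d :: t) ∈ L := by simpa using hw
    have := hclosed (gscoL_cross hv hw')
    obtain ⟨v', h'⟩ := ih (p ++ [c]) d ⟨t, by simpa using this⟩ h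
    exact ⟨v', by simpa using h'⟩

theorem chain_of_mem {α : Type*} {R : α → α → Prop} (w : List α)
    (h : ∀ a b, IsFactor [a, b] w → R a b) : List.IsChain R w := by
  rw [List.isChain_iff_forall_rel_of_append_cons_cons]
  intro a b l₁ l₂ e
  exact h a b ⟨l₁, l₂, by simp [e]⟩

/-- for a crossover language `L` without the empty word,
`L = (GSCO*(B) ∩ SΣ*E) ∪ (L ∩ Σ)`, where `B` is the set of length-two factors of
words of `L`, `S` the set of first letters and `E` the set of last letters of
words of `L`. -/
theorem crossover_decomposition {α : Type*} [Fintype α] (L : Set (List α))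
    (hε : [] ∉ L) (hclosed : gscoL L ⊆ L)
    (B : Set (List α)) (hB : B = {x | x.length = 2 ∧ ∃ w ∈ L, IsFactor x w})
    (S : Set α) (hS : S = {a | ∃ w ∈ L, ∃ v, w = a :: v})
    (E : Set α) (hE : E = {b | ∃ w ∈ L, ∃ u, w = u ++ [b]}) :
    L = (gscoStar B ∩ {w | ∃ a ∈ S, ∃ b ∈ E, ∃ m, w = a :: (m ++ [b])}) ∪
        {w ∈ L | w.length = 1} := by
  have hR : ∀ a b, [a, b] ∈ B ↔ ∃ w ∈ L, IsFactor [a, b] w := by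
    intro a b; simp [hB]
  ext w
  constructor
  · intro hw
    match w, hw with
    | [], hw => exact absurd hw hε
    | [a], hw => exact Or.inr ⟨hw, rfl⟩
    | a :: b :: m, hw =>
      refine Or.inl ⟨star_of_chain m a b (chain_of_mem _ fun x y h => (hR x y).2 ⟨_, hw, h⟩), ?_⟩
      have e := List.dropLast_append_getLast (l := b :: m) (by simp)
      refine ⟨a, ?_, (b :: m).getLast (by simp), ?_, (b :: m).dropLast, by rw [e]⟩
      · rw [hS]; exact ⟨_, hw, _, rfl⟩
      · rw [hE]; exact ⟨_, hw, a :: (b :: m).dropLast, by rw [List.cons_append, e]⟩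
  · rintro (⟨hs, a, ha, b, hb, m, rfl⟩ | h)
    · have hc : List.IsChain (fun a b => ∃ w ∈ L, IsFactor [a, b] w) (a :: (m ++ [b])) := by
        refine chain_star (K := B) ?_ _ hs
        intro w hw
        have hl : w.length = 2 := by rw [hB] at hw; exact hw.1
        obtain ⟨x, y, rfl⟩ := List.length_eq_two.1 hl
        simpa using (hR x y).1 hw
      rw [hS] at ha
      rw [hE] at hb
      obtain ⟨w, hw, v, rfl⟩ := ha
      obtain ⟨w', hw', u, rfl⟩ := hb
      obtain ⟨v', h'⟩ := extend_chain hclosed (m ++ [b]) [] a ⟨v, hw⟩ hc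
      have h1 : (a :: m) ++ [b] ++ v' ∈ L := by simpa using h'
      have h2 : u ++ [b] ++ [] ∈ L := by simpa using hw'
      simpa using hclosed (gscoL_cross h1 h2)
    · exact h.1
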